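/- arXiv:1412.4908 — 2 statements merged into one kernel-verified Lean document; each statement's English description precedes it below -/
import Mathlib

section
/- (k-step fixed-point identity) If V⋆ : S → ℝ is a fixed point of the discounted Bellman operator T, z ∈ S is a fixed reference state, h⋆(x) = V⋆ x − V⋆ z, and λ⋆ = (1 − α)·V⋆ z, then for every integer k ≥ 0 and every x ∈ S, (Σ_{i=0}^{k−1} α^i) · λ⋆ + h⋆ x = T^k[h⋆] x. -/
open Finset

/-- Discounted Bellman operator `T[V](x) = max_a ∑_y P a x y * (R a x y + α * V y)`. -/
noncomputable def bellman {S A : Type*} [Fintype S] [Fintype A] [Nonempty A]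
    (P R : A → S → S → ℝ) (α : ℝ) (V : S → ℝ) : S → ℝ :=
  fun x => univ.sup' univ_nonempty fun a => ∑ y, P a x y * (R a x y + α * V y)

/-- Undiscounted Bellman operator `T̄[h](x) = max_a ∑_y P a x y * (R a x y + h y)`. -/
noncomputable def ubellman {S A : Type*} [Fintype S] [Fintype A] [Nonempty A]
    (P R : A → S → S → ℝ) (h : S → ℝ) : S → ℝ :=
  fun x => univ.sup' univ_nonempty fun a => ∑ y, P a x y * (R a x y + h y)

/-- Q-function Bellman operator. -/
noncomputable def qbellman {S A : Type*} [Fintype S] [Fintype A] [Nonempty A]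
    (P R : A → S → S → ℝ) (α : ℝ) (Q : S → A → ℝ) : S → A → ℝ :=
  fun x a => ∑ y, P a x y * (R a x y + α * univ.sup' univ_nonempty (Q y))

/-- Span seminorm `‖V‖_d = max V - min V`. -/
noncomputable def spanSeminorm {S : Type*} [Fintype S] [Nonempty S] (V : S → ℝ) : ℝ :=
  univ.sup' univ_nonempty V - univ.inf' univ_nonempty V

/-- Ergodicity assumption: for every sequence of `N` policies and every starting state `x`,
some state `y` is reached after `N` steps with probability at least `ρ`. -/
def ErgodicMDP {S A : Type*} [Fintype S] [DecidableEq S]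
    (P : A → S → S → ℝ) (ρ : ℝ) (N : ℕ) : Prop :=
  ∀ μ : Fin N → (S → A), ∀ x : S, ∃ y : S,
    ρ ≤ (List.ofFn fun i => Matrix.of fun x' y' => P (μ i x') x' y').prod x y

theorem bellman_sub_const {S A : Type*} [Fintype S] [Fintype A] [Nonempty A]
    (P R : A → S → S → ℝ) (hP1 : ∀ a x, ∑ y, P a x y = 1)
    (α : ℝ) (V : S → ℝ) (c : ℝ) :
    bellman P R α (fun y => V y - c) = fun x => bellman P R α V x - α * c := by
  funext x
  have key : ∀ a, ∑ y, P a x y * (R a x y + α * (V y - c))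
      = (∑ y, P a x y * (R a x y + α * V y)) - α * c := by
    intro a
    have h : α * c = ∑ y, P a x y * (α * c) := by
      rw [← Finset.sum_mul, hP1, one_mul]
    rw [h, ← Finset.sum_sub_distrib]
    exact Finset.sum_congr rfl fun y _ => by ring
  unfold bellman
  simp only [key]
  apply le_antisymm
  · refine Finset.sup'_le _ _ fun a ha => ?_
    exact sub_le_sub_right
      (Finset.le_sup' (fun a => ∑ y, P a x y * (R a x y + α * V y)) ha) _
  · rw [sub_le_iff_le_add]
    refine Finset.sup'_le _ _ fun a ha => ?_
    rw [← sub_le_iff_le_add]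
    exact Finset.le_sup' (fun a => (∑ y, P a x y * (R a x y + α * V y)) - α * c) ha

/-- k-step fixed-point identity. -/
theorem stmt_2 {S A : Type*} [Fintype S] [Fintype A] [Nonempty S] [Nonempty A]
    (P R : A → S → S → ℝ)
    (hP0 : ∀ a x y, 0 ≤ P a x y) (hP1 : ∀ a x, ∑ y, P a x y = 1)
    (α : ℝ) (hα0 : 0 < α) (hα1 : α < 1)
    (Vstar : S → ℝ) (hVstar : bellman P R α Vstar = Vstar)
    (z : S) :
    ∀ k : ℕ, ∀ x : S,
      (∑ i ∈ Finset.range k, α ^ i) * ((1 - α) * Vstar z) + (Vstar x - Vstar z)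
        = (bellman P R α)^[k] (fun y => Vstar y - Vstar z) x := by
  have main : ∀ k : ℕ, (bellman P R α)^[k] (fun y => Vstar y - Vstar z)
      = fun x => Vstar x - α ^ k * Vstar z := by
    intro k
    induction k with
    | zero => simp
    | succ k ih =>
      rw [Function.iterate_succ_apply', ih, bellman_sub_const P R hP1, hVstar]
      funext x
      ring
  intro k x
  rw [main k]
  have hg := mul_neg_geom_sum α k
  linear_combination (Vstar z) * hg
end

section
/- (Pointwise error of the weighted difference in terms of the bias error) For every integer k ≥ 0 and every x ∈ S, with h_k(x) = T^k[V₀] x − T^k[V₀] z, one has |(T^{k+1}[V₀] x − α·T^k[V₀] x)/(1 − α) − V⋆ x| ≤ 2·(max_{y∈S} |h_k y − h⋆ y|) / (1 − α). -/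
open Finset

theorem bellman_le_add {S A : Type*} [Fintype S] [Fintype A] [Nonempty A]
    (P R : A → S → S → ℝ)
    (hP0 : ∀ a x y, 0 ≤ P a x y) (hP1 : ∀ a x, ∑ y, P a x y = 1)
    (α : ℝ) (hα0 : 0 < α) (V W : S → ℝ) (d : ℝ) (h : ∀ y, V y ≤ W y + d) (x : S) :
    bellman P R α V x ≤ bellman P R α W x + α * d := by
  unfold bellman
  apply Finset.sup'_le
  intro a _
  have h1 : ∑ y, P a x y * (R a x y + α * V y)
      ≤ ∑ y, (P a x y * (R a x y + α * W y) + P a x y * (α * d)) := by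
    apply Finset.sum_le_sum
    intro y _
    have := mul_le_mul_of_nonneg_left (mul_le_mul_of_nonneg_left (h y) hα0.le) (hP0 a x y)
    linarith
  rw [Finset.sum_add_distrib, ← Finset.sum_mul, hP1, one_mul] at h1
  have h2 := Finset.le_sup' (fun a => ∑ y, P a x y * (R a x y + α * W y)) (Finset.mem_univ a)
  linarith

/-- Pointwise error of the weighted difference in terms of the bias error. -/
theorem stmt_6 {S A : Type*} [Fintype S] [Fintype A] [Nonempty S] [Nonempty A]
    (P R : A → S → S → ℝ)
    (hP0 : ∀ a x y, 0 ≤ P a x y) (hP1 : ∀ a x, ∑ y, P a x y = 1)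
    (α : ℝ) (hα0 : 0 < α) (hα1 : α < 1)
    (Vstar : S → ℝ) (hVstar : bellman P R α Vstar = Vstar)
    (z : S) (V₀ : S → ℝ) :
    ∀ k : ℕ, ∀ x : S,
      |((bellman P R α)^[k + 1] V₀ x - α * (bellman P R α)^[k] V₀ x) / (1 - α) - Vstar x|
        ≤ 2 * (univ.sup' univ_nonempty fun y =>
            |((bellman P R α)^[k] V₀ y - (bellman P R α)^[k] V₀ z)
              - (Vstar y - Vstar z)|) / (1 - α) := by
  intro k x
  rw [Function.iterate_succ_apply']
  generalize (bellman P R α)^[k] V₀ = V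
  have hM : ∀ y, |(V y - V z) - (Vstar y - Vstar z)| ≤ univ.sup' univ_nonempty fun y =>
      |(V y - V z) - (Vstar y - Vstar z)| := fun y =>
    Finset.le_sup' (fun y => |(V y - V z) - (Vstar y - Vstar z)|) (Finset.mem_univ y)
  generalize (univ.sup' univ_nonempty fun y =>
      |(V y - V z) - (Vstar y - Vstar z)|) = M at hM ⊢
  have hM0 : 0 ≤ M := (abs_nonneg _).trans (hM x)
  have hpos : 0 < 1 - α := by linarith
  have h1 := bellman_le_add P R hP0 hP1 α hα0 V Vstar (V z - Vstar z + M)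
    (fun y => by have := (abs_le.mp (hM y)).2; linarith) x
  have h2 := bellman_le_add P R hP0 hP1 α hα0 Vstar V (M - (V z - Vstar z))
    (fun y => by have := (abs_le.mp (hM y)).1; linarith) x
  rw [hVstar] at h1 h2
  have h3 := mul_le_mul_of_nonneg_left (abs_le.mp (hM x)).1 hα0.le
  have h4 := mul_le_mul_of_nonneg_left (abs_le.mp (hM x)).2 hα0.le
  have h5 : α * M ≤ M := by nlinarith
  have e : (bellman P R α V x - α * V x) / (1 - α) - Vstar x
      = (bellman P R α V x - α * V x - (1 - α) * Vstar x) / (1 - α) := by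
    field_simp
  rw [e, abs_div, abs_of_pos hpos]
  apply div_le_div_of_nonneg_right _ hpos.le
  rw [abs_le]
  constructor <;> linarith
end
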